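/- Classical converse core inequality for the degraded toy broadcast channel over F_q (Theorem 5, converse): Let F be a finite field with q = |F| ≥ 3 elements. Let X1, X2 : Ω → F be random variables, let U : Ω → S be a random variable valued in a finite set S, and let G : Ω → F be uniform on F^× and independent of the triple (X1, X2, U). Then (1/2)·H[(X1, X2) | U] + I[U : G·X1 + X2 | G] ≤ log q. -/

import Mathlib

open MeasureTheory ProbabilityTheory

/-- Shannon entropy (natural logarithm) of a finitely-valued random variable `X`. -/
noncomputable def shannonEntropy {Ω : Type*} [MeasurableSpace Ω] (μ : Measure Ω)
    {A : Type*} [Fintype A] (X : Ω → A) : ℝ :=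
  ∑ a : A, Real.negMulLog (μ (X ⁻¹' {a})).toReal

/-- Conditional Shannon entropy `H[X | Y] = ∑ b, P[Y = b] · H[X | Y = b]`. -/
noncomputable def condShannonEntropy {Ω : Type*} [MeasurableSpace Ω] (μ : Measure Ω)
    {A B : Type*} [Fintype A] [Fintype B] (X : Ω → A) (Y : Ω → B) : ℝ :=
  ∑ b : B, (μ (Y ⁻¹' {b})).toReal *
    shannonEntropy (ProbabilityTheory.cond μ (Y ⁻¹' {b})) X

/-- Mutual information `I[X : Y] = H[X] + H[Y] - H[(X, Y)]`. -/
noncomputable def mutualInfoRV {Ω : Type*} [MeasurableSpace Ω] (μ : Measure Ω)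
    {A B : Type*} [Fintype A] [Fintype B] (X : Ω → A) (Y : Ω → B) : ℝ :=
  shannonEntropy μ X + shannonEntropy μ Y - shannonEntropy μ (fun ω => (X ω, Y ω))

/-- Conditional mutual information `I[X : Y | Z] = ∑ c, P[Z = c] · I[X : Y | Z = c]`. -/
noncomputable def condMutualInfoRV {Ω : Type*} [MeasurableSpace Ω] (μ : Measure Ω)
    {A B C : Type*} [Fintype A] [Fintype B] [Fintype C]
    (X : Ω → A) (Y : Ω → B) (Z : Ω → C) : ℝ :=
  ∑ c : C, (μ (Z ⁻¹' {c})).toReal *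
    mutualInfoRV (ProbabilityTheory.cond μ (Z ⁻¹' {c})) X Y

/-- Gibbs' inequality. -/
theorem sum_negMulLog_le_of_sum_le {A : Type*} [Fintype A] (p r : A → ℝ)
    (hp : ∀ a, 0 ≤ p a) (hr : ∀ a, 0 ≤ r a) (hpr : ∀ a, r a = 0 → p a = 0)
    (hsum : ∑ a, r a ≤ ∑ a, p a) :
    ∑ a, Real.negMulLog (p a) ≤ -∑ a, p a * Real.log (r a) := by
  have key : ∀ a, Real.negMulLog (p a) + p a * Real.log (r a) ≤ r a - p a := by
    intro a
    rcases (hp a).eq_or_lt with h | h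
    · simp [← h, hr a]
    · have hra : 0 < r a := (hr a).lt_of_ne fun h0 => h.ne' (hpr a h0.symm)
      have hlog := mul_le_mul_of_nonneg_left
        (Real.log_le_sub_one_of_pos (div_pos hra h)) h.le
      rw [Real.log_div hra.ne' h.ne', mul_sub, mul_sub, mul_div_cancel₀ _ h.ne'] at hlog
      rw [Real.negMulLog]
      linarith
  have hkey := Finset.sum_le_sum fun a (_ : a ∈ Finset.univ) => key a
  rw [Finset.sum_add_distrib, Finset.sum_sub_distrib] at hkey
  linarith

theorem preimage_prodMk_singleton {Ω A B : Type*} (X : Ω → A) (Y : Ω → B) (a : A)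
    (b : B) :
    (fun ω => (X ω, Y ω)) ⁻¹' {(a, b)} = X ⁻¹' {a} ∩ Y ⁻¹' {b} := by
  ext ω
  simp

theorem shannonEntropy_comp_of_bijective {Ω A B : Type*} [MeasurableSpace Ω]
    [Fintype A] [Fintype B] (μ : Measure Ω) (X : Ω → A) {f : A → B} (hf : Function.Bijective f) :
    shannonEntropy μ (fun ω => f (X ω)) = shannonEntropy μ X := by
  rw [shannonEntropy, ← hf.sum_comp]
  refine Finset.sum_congr rfl fun a _ => ?_
  congr 3
  ext ω
  simp [hf.injective.eq_iff]

section Entropy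

variable {Ω : Type*} [Finite Ω] [MeasurableSpace Ω] [MeasurableSingletonClass Ω]
  {A B : Type*} [Fintype A] [Fintype B]

theorem sum_toReal_measure_inter_preimage (μ : Measure Ω) [IsFiniteMeasure μ]
    (s : Set Ω) (X : Ω → A) :
    ∑ a, (μ (s ∩ X ⁻¹' {a})).toReal = (μ s).toReal := by
  rw [← ENNReal.toReal_sum fun a _ => measure_ne_top _ _]
  congr 1
  have h := sum_measure_preimage_singleton (μ := μ.restrict s) (f := X) Finset.univ
    fun a _ => (Set.toFinite (X ⁻¹' {a})).measurableSet
  simp only [Measure.restrict_apply (Set.toFinite _).measurableSet, Finset.coe_univ,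
    Set.preimage_univ, Set.univ_inter] at h
  simpa only [Set.inter_comm] using h

theorem sum_toReal_measure_preimage (μ : Measure Ω) [IsProbabilityMeasure μ] (X : Ω → A) :
    ∑ a, (μ (X ⁻¹' {a})).toReal = 1 := by
  simpa using sum_toReal_measure_inter_preimage μ Set.univ X

theorem shannonEntropy_le_log_card (μ : Measure Ω) [IsProbabilityMeasure μ]
    [Nonempty A] (X : Ω → A) :
    shannonEntropy μ X ≤ Real.log (Fintype.card A) := by
  have hcard : (Fintype.card A : ℝ) ≠ 0 := by simp
  have h := sum_negMulLog_le_of_sum_le (fun a => (μ (X ⁻¹' {a})).toReal)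
    (fun _ => (Fintype.card A : ℝ)⁻¹) (fun _ => ENNReal.toReal_nonneg)
    (fun _ => by positivity) (fun _ h0 => absurd h0 (inv_ne_zero hcard))
    (by rw [sum_toReal_measure_preimage]; simp)
  rwa [← Finset.sum_mul, sum_toReal_measure_preimage, one_mul, Real.log_inv, neg_neg] at h

theorem shannonEntropy_prodMk_le_add (μ : Measure Ω) [IsProbabilityMeasure μ]
    (X : Ω → A) (Y : Ω → B) :
    shannonEntropy μ (fun ω => (X ω, Y ω)) ≤ shannonEntropy μ X + shannonEntropy μ Y := by
  set p : A × B → ℝ := fun c => (μ (X ⁻¹' {c.1} ∩ Y ⁻¹' {c.2})).toReal with hp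
  set pX : A → ℝ := fun a => (μ (X ⁻¹' {a})).toReal
  set pY : B → ℝ := fun b => (μ (Y ⁻¹' {b})).toReal with hpY
  have margX : ∀ a, ∑ b, p (a, b) = pX a := fun a =>
    sum_toReal_measure_inter_preimage μ (X ⁻¹' {a}) Y
  have margY : ∀ b, ∑ a, p (a, b) = pY b := fun b => by
    simpa only [hp, hpY, Set.inter_comm] using
      sum_toReal_measure_inter_preimage μ (Y ⁻¹' {b}) X
  have sumX : ∑ a, pX a = 1 := sum_toReal_measure_preimage μ X
  have sumY : ∑ b, pY b = 1 := sum_toReal_measure_preimage μ Y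
  have p_nonneg : ∀ c, 0 ≤ p c := fun c => ENNReal.toReal_nonneg
  have p_le_X : ∀ c, p c ≤ pX c.1 := fun c =>
    ENNReal.toReal_mono (measure_ne_top _ _) (measure_mono Set.inter_subset_left)
  have p_le_Y : ∀ c, p c ≤ pY c.2 := fun c =>
    ENNReal.toReal_mono (measure_ne_top _ _) (measure_mono Set.inter_subset_right)
  have p_eq_zero : ∀ c, pX c.1 * pY c.2 = 0 → p c = 0 := by
    intro c h
    rcases mul_eq_zero.1 h with h | h
    · exact le_antisymm (h ▸ p_le_X c) (p_nonneg c)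
    · exact le_antisymm (h ▸ p_le_Y c) (p_nonneg c)
  have gibbs := sum_negMulLog_le_of_sum_le p (fun c => pX c.1 * pY c.2) p_nonneg
    (fun c => mul_nonneg ENNReal.toReal_nonneg ENNReal.toReal_nonneg) p_eq_zero
    (by simp only [Fintype.sum_prod_type, margX, ← Finset.mul_sum, sumX, sumY, mul_one, le_refl])
  have split : ∀ c, p c * Real.log (pX c.1 * pY c.2) =
      p c * Real.log (pX c.1) + p c * Real.log (pY c.2) := by
    intro c
    by_cases h : pX c.1 * pY c.2 = 0
    · simp [p_eq_zero c h]
    · rw [Real.log_mul (left_ne_zero_of_mul h) (right_ne_zero_of_mul h), mul_add]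
  have sum_logX : ∑ c, p c * Real.log (pX c.1) = ∑ a, pX a * Real.log (pX a) := by
    simp only [Fintype.sum_prod_type, ← Finset.sum_mul, margX]
  have sum_logY : ∑ c, p c * Real.log (pY c.2) = ∑ b, pY b * Real.log (pY b) := by
    simp only [Fintype.sum_prod_type_right, ← Finset.sum_mul, margY]
  simp only [split, Finset.sum_add_distrib, sum_logX, sum_logY] at gibbs
  have joint : shannonEntropy μ (fun ω => (X ω, Y ω)) = ∑ c, Real.negMulLog (p c) :=
    Finset.sum_congr rfl fun c _ => by simp only [hp, ← preimage_prodMk_singleton]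
  rw [joint]
  simp only [shannonEntropy, Real.negMulLog, neg_mul, Finset.sum_neg_distrib] at gibbs ⊢
  linarith

theorem shannonEntropy_prodMk_eq_add_cond (μ : Measure Ω) [IsProbabilityMeasure μ]
    (U : Ω → A) (Y : Ω → B) :
    shannonEntropy μ (fun ω => (U ω, Y ω)) =
      shannonEntropy μ U + condShannonEntropy μ Y U := by
  simp only [shannonEntropy, condShannonEntropy, Fintype.sum_prod_type,
    ← Finset.sum_add_distrib]
  refine Finset.sum_congr rfl fun u _ => ?_
  have hprod : ∀ y, (μ ((fun ω => (U ω, Y ω)) ⁻¹' {(u, y)})).toReal =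
      (μ (U ⁻¹' {u})).toReal * (μ[Y ⁻¹' {y} | U ⁻¹' {u}]).toReal := by
    intro y
    rw [preimage_prodMk_singleton, ← cond_mul_eq_inter (Set.toFinite _).measurableSet,
      ENNReal.toReal_mul, mul_comm]
  simp only [hprod, Real.negMulLog_mul, Finset.sum_add_distrib, ← Finset.sum_mul,
    ← Finset.mul_sum]
  by_cases h : μ (U ⁻¹' {u}) = 0
  · simp [h]
  · have := cond_isProbabilityMeasure h
    rw [sum_toReal_measure_preimage, one_mul]

end Entropy

/-- Conditioning on an event independent of each atom of `T` preserves the law of `T`. -/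
theorem cond_preimage_eq_of_indep_singleton {Ω T : Type*} [Finite Ω] [MeasurableSpace Ω]
    [MeasurableSingletonClass Ω] [Finite T] (μ : Measure Ω) [IsFiniteMeasure μ]
    (Z : Ω → T) {s : Set Ω} (hs : μ s ≠ 0)
    (h : ∀ t, μ (s ∩ Z ⁻¹' {t}) = μ s * μ (Z ⁻¹' {t})) (E : Set T) :
    μ[Z ⁻¹' E | s] = μ (Z ⁻¹' E) := by
  have hatom : ∀ t, μ[Z ⁻¹' {t} | s] = μ (Z ⁻¹' {t}) := fun t => by
    rw [cond_apply (Set.toFinite s).measurableSet, h, ← mul_assoc,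
      ENNReal.inv_mul_cancel hs (measure_ne_top _ _), one_mul]
  rw [← (Set.toFinite E).coe_toFinset,
    ← sum_measure_preimage_singleton _ fun t _ => (Set.toFinite (Z ⁻¹' {t})).measurableSet,
    ← sum_measure_preimage_singleton _ fun t _ => (Set.toFinite (Z ⁻¹' {t})).measurableSet]
  exact Finset.sum_congr rfl fun t _ => hatom t

/-- Two linear forms with distinct slopes determine a pair of field elements. -/
theorem bijective_linear_forms {F : Type*} [Field F] [Finite F] {g g' : F} (hg : g ≠ g') :
    Function.Bijective fun x : F × F => (g * x.1 + x.2, g' * x.1 + x.2) := by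
  refine Finite.injective_iff_bijective.1 ?_
  rintro ⟨x1, x2⟩ ⟨y1, y2⟩ h
  obtain ⟨h1, h2⟩ := Prod.mk.inj h
  dsimp only at h1 h2
  have hx : x1 = y1 := mul_left_cancel₀ (sub_ne_zero.2 hg) (by linear_combination h1 - h2)
  subst hx
  rw [add_left_cancel h1]

theorem condShannonEntropy_pair_le_linear_forms {Ω F S : Type*} [Finite Ω]
    [MeasurableSpace Ω] [MeasurableSingletonClass Ω] [Field F] [Fintype F] [Fintype S]
    (μ : Measure Ω) [IsProbabilityMeasure μ] (X1 X2 : Ω → F) (U : Ω → S)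
    {g g' : F} (hg : g ≠ g') :
    condShannonEntropy μ (fun ω => (X1 ω, X2 ω)) U ≤
      condShannonEntropy μ (fun ω => g * X1 ω + X2 ω) U +
        condShannonEntropy μ (fun ω => g' * X1 ω + X2 ω) U := by
  simp only [condShannonEntropy, ← Finset.sum_add_distrib, ← mul_add]
  refine Finset.sum_le_sum fun u _ => ?_
  by_cases h : μ (U ⁻¹' {u}) = 0
  · simp [h]
  · have := cond_isProbabilityMeasure h
    refine mul_le_mul_of_nonneg_left ?_ ENNReal.toReal_nonneg
    rw [← shannonEntropy_comp_of_bijective _ _ (bijective_linear_forms hg)]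
    exact shannonEntropy_prodMk_le_add _ _ _

theorem mutualInfoRV_cond_linear_form {Ω F S : Type*} [Finite Ω]
    [MeasurableSpace Ω] [MeasurableSingletonClass Ω] [Field F] [Fintype F] [Fintype S]
    (μ : Measure Ω) [IsProbabilityMeasure μ] (X1 X2 : Ω → F) (U : Ω → S) (G : Ω → F)
    (g : F) (hg : μ (G ⁻¹' {g}) ≠ 0)
    (hindep : ∀ t : F × F × S,
      μ (G ⁻¹' {g} ∩ (fun ω => (X1 ω, X2 ω, U ω)) ⁻¹' {t}) =
        μ (G ⁻¹' {g}) * μ ((fun ω => (X1 ω, X2 ω, U ω)) ⁻¹' {t})) :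
    mutualInfoRV (ProbabilityTheory.cond μ (G ⁻¹' {g})) U (fun ω => G ω * X1 ω + X2 ω) =
      shannonEntropy μ (fun ω => g * X1 ω + X2 ω) -
        condShannonEntropy μ (fun ω => g * X1 ω + X2 ω) U := by
  have law := cond_preimage_eq_of_indep_singleton μ _ hg hindep
  have slice : ∀ s t : Set Ω, G ⁻¹' {g} ∩ s = G ⁻¹' {g} ∩ t →
      μ[s | G ⁻¹' {g}] = μ[t | G ⁻¹' {g}] := fun s t h => by
    rw [← cond_inter_self (Set.toFinite _).measurableSet, h,
      cond_inter_self (Set.toFinite _).measurableSet]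
  have hU : shannonEntropy (ProbabilityTheory.cond μ (G ⁻¹' {g})) U = shannonEntropy μ U :=
    Finset.sum_congr rfl fun u _ => by
      congr 2
      exact law {t | t.2.2 = u}
  have hV : shannonEntropy (ProbabilityTheory.cond μ (G ⁻¹' {g}))
      (fun ω => G ω * X1 ω + X2 ω) = shannonEntropy μ (fun ω => g * X1 ω + X2 ω) :=
    Finset.sum_congr rfl fun v _ => by
      congr 2
      refine (slice _ _ ?_).trans (law {t | g * t.1 + t.2.1 = v})
      ext ω
      simp +contextual
  have hUV : shannonEntropy (ProbabilityTheory.cond μ (G ⁻¹' {g}))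
      (fun ω => (U ω, G ω * X1 ω + X2 ω)) =
        shannonEntropy μ (fun ω => (U ω, g * X1 ω + X2 ω)) :=
    Finset.sum_congr rfl fun v _ => by
      congr 2
      refine (slice _ _ ?_).trans (law {t | (t.2.2, g * t.1 + t.2.1) = v})
      ext ω
      simp +contextual
  rw [mutualInfoRV, hU, hV, hUV, shannonEntropy_prodMk_eq_add_cond]
  ring

/-- **Classical converse core inequality for the degraded toy BC over `F_q`** (Theorem 5,
converse): for a finite field `F` with `q = |F| ≥ 3`, if `G` is uniform on `F^×` and
independent of `(X1, X2, U)`, then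
`(1/2)·H[(X1, X2) | U] + I[U : G·X1 + X2 | G] ≤ log q`. -/
theorem toy2_Fq_converse_core
    {Ω : Type*} [Fintype Ω] [MeasurableSpace Ω] [MeasurableSingletonClass Ω]
    (μ : Measure Ω) [IsProbabilityMeasure μ]
    {F : Type*} [Field F] [Fintype F] [DecidableEq F]
    (hq : 3 ≤ Fintype.card F)
    {S : Type*} [Fintype S]
    (X1 X2 : Ω → F) (U : Ω → S) (G : Ω → F)
    (hG : ∀ g : F, μ (G ⁻¹' {g}) =
      if g = 0 then 0 else ((Fintype.card F : ENNReal) - 1)⁻¹)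
    (hindep : ∀ (g x1 x2 : F) (u : S),
      μ (G ⁻¹' {g} ∩ (fun ω => (X1 ω, X2 ω, U ω)) ⁻¹' {(x1, x2, u)}) =
        μ (G ⁻¹' {g}) * μ ((fun ω => (X1 ω, X2 ω, U ω)) ⁻¹' {(x1, x2, u)})) :
    (1 / 2) * condShannonEntropy μ (fun ω => (X1 ω, X2 ω)) U +
      condMutualInfoRV μ U (fun ω => G ω * X1 ω + X2 ω) G ≤
        Real.log (Fintype.card F) := by
  obtain ⟨a, -, ha⟩ : ∃ a ∈ (Finset.univ : Finset F), a ∉ ({0, 1} : Finset F) :=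
    Finset.exists_mem_notMem_of_card_lt_card
      (Finset.card_le_two.trans_lt (by rw [Finset.card_univ]; omega))
  obtain ⟨ha0, ha1⟩ : a ≠ 0 ∧ a ≠ 1 := by simpa using ha
  set w : F → ℝ := fun g => (μ (G ⁻¹' {g})).toReal with hw
  set C := condShannonEntropy μ (fun ω => (X1 ω, X2 ω)) U
  set h : F → ℝ := fun g => condShannonEntropy μ (fun ω => g * X1 ω + X2 ω) U
  have w_nonneg : ∀ g, 0 ≤ w g := fun g => ENNReal.toReal_nonneg
  have w_zero : w 0 = 0 := by simp [hw, hG]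
  have w_sum : ∑ g, w g = 1 := sum_toReal_measure_preimage μ G
  have w_mul : ∀ g, w (a * g) = w g := fun g => by simp [hw, hG, ha0]
  have pair_le : ∀ g, w g * C ≤ w g * h g + w (a * g) * h (a * g) := by
    intro g
    rw [w_mul, ← mul_add]
    rcases eq_or_ne g 0 with rfl | hg
    · simp [w_zero]
    · refine mul_le_mul_of_nonneg_left ?_ (w_nonneg g)
      refine condShannonEntropy_pair_le_linear_forms μ X1 X2 U fun hga => ha1 ?_
      exact mul_right_cancel₀ hg (by rw [one_mul]; exact hga.symm)
  have C_le : C ≤ 2 * ∑ g, w g * h g := by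
    have hsum := Finset.sum_le_sum fun g (_ : g ∈ Finset.univ) => pair_le g
    rw [← Finset.sum_mul, w_sum, one_mul, Finset.sum_add_distrib,
      (mulLeft_bijective₀ a ha0).sum_comp fun g => w g * h g] at hsum
    linarith
  have info_le : condMutualInfoRV μ U (fun ω => G ω * X1 ω + X2 ω) G ≤
      ∑ g, w g * (Real.log (Fintype.card F) - h g) := by
    refine Finset.sum_le_sum fun g _ => ?_
    by_cases hg : μ (G ⁻¹' {g}) = 0
    · simp [hw, hg]
    · refine mul_le_mul_of_nonneg_left ?_ (w_nonneg g)
      rw [mutualInfoRV_cond_linear_form μ X1 X2 U G g hg fun t => hindep g t.1 t.2.1 t.2.2]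
      exact sub_le_sub_right (shannonEntropy_le_log_card μ _) _
  simp only [mul_sub, Finset.sum_sub_distrib, ← Finset.sum_mul, w_sum, one_mul] at info_le
  linarith
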